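/- arXiv:2402.10121 — 2 statements merged into one kernel-verified Lean document; each statement's English description precedes it below -/
import Mathlib

section
/- If $k > 2$ is an even positive integer not divisible by $6$, then $v_2(m(k)) = v_2(k) + 1$, where $v_2$ denotes the $2$-adic valuation. -/
open Polynomial

/-- `J(k,R)`: the additive subgroup of `R` generated by `k`-th powers of elements of `R`. -/
def Jgrp (k : ℕ) (R : Type*) [CommRing R] : AddSubgroup R :=
  AddSubgroup.closure {r : R | ∃ g : R, r = g ^ k}

/-- `G(k,R) = {m : ℤ | ∀ r : R, m • r ∈ J(k,R)}`, an additive subgroup of `ℤ`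
(realized as an ideal of `ℤ`, which has the same underlying set). -/
def Ggrp (k : ℕ) (R : Type*) [CommRing R] : Ideal ℤ where
  carrier := {m : ℤ | ∀ r : R, m • r ∈ Jgrp k R}
  add_mem' := fun {a b} ha hb r => by
    simpa [add_smul] using (Jgrp k R).add_mem (ha r) (hb r)
  zero_mem' := fun r => by simpa using (Jgrp k R).zero_mem
  smul_mem' := fun c m hm r => by
    have h := hm (c • r)
    rw [smul_smul, mul_comm] at h
    simpa [smul_smul] using h

/-- `m(k,R)`: the nonnegative generator of `G(k,R)`. -/
noncomputable def mval (k : ℕ) (R : Type*) [CommRing R] : ℕ :=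
  (Submodule.IsPrincipal.generator (Ggrp k R)).natAbs

lemma nat_aux (k a j : ℕ) (hk : 2 ^ a ∣ k) (hj : 3 ≤ j) : 2 ^ (a + 2) ∣ 2 ^ j * k.choose j := by
  obtain ⟨e, j', hodd, hje⟩ := Nat.exists_eq_two_pow_mul_odd (n := j) (by omega)
  have he : e + 2 ≤ j := by
    by_contra hlt
    have h1 : 2 ^ (j - 1) ≤ 2 ^ e := Nat.pow_le_pow_right (by norm_num) (by omega)
    have h2 : 2 ^ e ≤ j := Nat.le_of_dvd (by omega) ⟨j', hje⟩
    obtain ⟨t, rfl⟩ : ∃ t, j = t + 3 := ⟨j - 3, by omega⟩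
    have h3 : t + 3 < 2 ^ (t + 2) := by
      have : t < 2 ^ t := Nat.lt_two_pow_self
      rw [pow_add]; omega
    have : t + 3 - 1 = t + 2 := by omega
    rw [this] at h1
    omega
  have h1 : 2 ^ a ∣ j * k.choose j := by
    rcases Nat.eq_zero_or_pos k with rfl | hkp
    · rw [Nat.choose_eq_zero_of_lt (by omega)]; simp
    · obtain ⟨k', rfl⟩ : ∃ t, k = t + 1 := ⟨k - 1, by omega⟩
      obtain ⟨i, rfl⟩ : ∃ t, j = t + 1 := ⟨j - 1, by omega⟩
      have := Nat.add_one_mul_choose_eq k' i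
      rw [mul_comm (i+1), ← this]
      exact Dvd.dvd.mul_right hk _
  have h2 : 2 ^ a ∣ 2 ^ e * k.choose j := by
    have hc : Nat.Coprime (2 ^ a) j' := Nat.Coprime.pow_left _ (Nat.coprime_two_left.mpr hodd)
    apply hc.dvd_of_dvd_mul_left
    have : j' * (2 ^ e * k.choose j) = j * k.choose j := by
      generalize k.choose j = z
      rw [hje]; ring
    rw [this]; exact h1
  have h3 : 2 ^ e * 2 ^ (a + 2) ∣ 2 ^ e * (2 ^ j * k.choose j) := by
    calc 2 ^ e * 2 ^ (a + 2) ∣ 2 ^ j * 2 ^ a := by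
          rw [← pow_add, ← pow_add]; exact pow_dvd_pow _ (by omega)
      _ ∣ 2 ^ j * (2 ^ e * k.choose j) := mul_dvd_mul_left _ h2
      _ = _ := by ring
  exact Nat.dvd_of_mul_dvd_mul_left (by positivity) h3

section
variable {R : Type*} [CommRing R]

lemma pow_mem_J (k : ℕ) (g : R) : g ^ k ∈ Jgrp k R := AddSubgroup.subset_closure ⟨g, rfl⟩

lemma expand (k a : ℕ) (hk : 2 ^ a ∣ k) (hk2 : 2 ≤ k) (f h : R) :
    ∃ w : R, (f + 2 * h) ^ k = f ^ k + 2 * k * (f ^ (k-1) * h)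
      + 2 * k * ((k : R) - 1) * (f ^ (k-2) * h ^ 2) + 2 ^ (a + 2) * w := by
  have hdvd : (2 : R) ^ (a + 2) ∣ ∑ i ∈ Finset.range (k - 2),
      (2 * h) ^ (i + 3) * f ^ (k - (i + 3)) * (k.choose (i + 3) : R) := by
    apply Finset.dvd_sum
    intro i _
    have := nat_aux k a (i + 3) hk (by omega)
    have h2 : (2 : R) ^ (a + 2) ∣ 2 ^ (i + 3) * (k.choose (i + 3) : R) := by
      have := map_dvd (Nat.castRingHom R) this
      simpa using this
    rw [mul_pow]
    calc _ ∣ _ := h2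
      _ ∣ 2 ^ (i + 3) * (k.choose (i + 3) : R) * (h ^ (i + 3) * f ^ (k - (i + 3))) :=
        Dvd.intro _ rfl
      _ = _ := by ring
  obtain ⟨w, hw⟩ := hdvd
  refine ⟨w, ?_⟩
  rw [add_comm f, add_pow, ← hw]
  have : k + 1 = k - 2 + 3 := by omega
  rw [this, Finset.sum_range_succ', Finset.sum_range_succ', Finset.sum_range_succ']
  have hc : 2 * (k.choose 2 : R) = k * ((k : R) - 1) := by
    obtain ⟨t, rfl⟩ : ∃ t, k = t + 1 := ⟨k - 1, by omega⟩
    have h1 := Nat.add_one_mul_choose_eq t 1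
    have h2 := congrArg (Nat.cast : ℕ → R) h1
    push_cast at h2 ⊢
    simp at h2 ⊢
    linear_combination -h2
  simp only [zero_add, pow_zero, Nat.choose_zero_right, Nat.choose_one_right, Nat.sub_zero,
    Nat.cast_one, pow_one, Nat.reduceAdd, add_assoc]
  linear_combination (2 * h ^ 2 * f ^ (k - 2)) * hc

/-- auxiliary subgroup -/
def Vgrp (k a : ℕ) (R : Type*) [CommRing R] : AddSubgroup R where
  carrier := {v | ∃ j ∈ Jgrp k R, ∃ w : R, 2 ^ (a + 1) * v = j + 2 ^ (a + 2) * w}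
  zero_mem' := ⟨0, zero_mem _, 0, by simp⟩
  add_mem' := by
    rintro x y ⟨j, hj, w, h⟩ ⟨j', hj', w', h'⟩
    exact ⟨j + j', add_mem hj hj', w + w', by linear_combination h + h'⟩
  neg_mem' := by
    rintro x ⟨j, hj, w, h⟩
    exact ⟨-j, neg_mem hj, -w, by linear_combination -h⟩

lemma two_mul_mem_V (k a : ℕ) (r : R) : 2 * r ∈ Vgrp k a R :=
  ⟨0, zero_mem _, r, by ring⟩

lemma mem_V_of (k a q : ℕ) (hk : k = 2 ^ a * (2 * q + 1)) (v j w : R) (hj : j ∈ Jgrp k R)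
    (h : 2 * k * v = j + 2 ^ (a + 2) * w) : v ∈ Vgrp k a R := by
  refine ⟨j, hj, w - q * v, ?_⟩
  have : (k : R) = 2 ^ a * (2 * q + 1) := by rw [hk]; push_cast; ring
  rw [this] at h
  linear_combination h

lemma pow_mem_V (k a q : ℕ) (hk : k = 2 ^ a * (2 * q + 1)) (f : R) : f ^ k ∈ Vgrp k a R := by
  refine mem_V_of k a q hk _ ((2 * k : ℕ) • f ^ k) 0 (nsmul_mem (pow_mem_J k f) _) ?_
  simp

lemma fh_mem_V (k a q : ℕ) (hk : k = 2 ^ a * (2 * q + 1)) (ha : 1 ≤ a) (f h : R) :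
    f ^ (k - 2) * (f * h + h ^ 2) ∈ Vgrp k a R := by
  have hk2 : 2 ≤ k := by
    rw [hk]
    calc 2 = 2 ^ 1 * 1 := by norm_num
      _ ≤ _ := Nat.mul_le_mul (Nat.pow_le_pow_right (by norm_num) ha) (by omega)
  obtain ⟨w, hw⟩ := expand k a ⟨_, hk⟩ hk2 f h
  obtain ⟨b, rfl⟩ : ∃ b, a = b + 1 := ⟨a - 1, by omega⟩
  have hkR : (k : R) = 2 ^ (b + 1) * (2 * q + 1) := by rw [hk]; push_cast; ring
  refine mem_V_of k (b + 1) q hk _ ((f + 2 * h) ^ k - f ^ k)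
    (-w - (2 * q + 1) * (2 ^ b * (2 * q + 1) - 1) * (f ^ (k - 2) * h ^ 2))
    (sub_mem (pow_mem_J _ _) (pow_mem_J _ _)) ?_
  have hf : f ^ (k - 1) = f ^ (k - 2) * f := by
    rw [← pow_succ]; congr 1; omega
  rw [hf] at hw
  rw [hw, hkR]
  ring

lemma sq_mem_V (k a q : ℕ) (hk : k = 2 ^ a * (2 * q + 1)) (ha : 1 ≤ a) (h : R) :
    h ^ 2 - h ∈ Vgrp k a R := by
  have h1 := fh_mem_V k a q hk ha 1 h
  have h2 := sub_mem h1 (two_mul_mem_V k a h)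
  convert h2 using 1
  simp; ring

lemma pow2_mem_V (k a q : ℕ) (hk : k = 2 ^ a * (2 * q + 1)) (ha : 1 ≤ a) (h : R) (n : ℕ) :
    h ^ (2 ^ n) - h ∈ Vgrp k a R := by
  induction n with
  | zero => simp [zero_mem]
  | succ n ih =>
    have := add_mem (sq_mem_V k a q hk ha (h ^ 2 ^ n)) ih
    convert this using 1
    ring

/-- largest ideal inside V -/
def Iid (k a : ℕ) (R : Type*) [CommRing R] : Ideal R where
  carrier := {h | ∀ r, r * h ∈ Vgrp k a R}
  zero_mem' := fun r => by simp [zero_mem]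
  add_mem' := fun {x y} hx hy r => by rw [mul_add]; exact add_mem (hx r) (hy r)
  smul_mem' := fun c x hx r => by
    have := hx (r * c)
    rwa [mul_assoc] at this

lemma I_le (k a : ℕ) (h : R) (hh : h ∈ Iid k a R) : h ∈ Vgrp k a R := by
  simpa using hh 1

lemma I_rad (k a q : ℕ) (hk : k = 2 ^ a * (2 * q + 1)) (ha : 1 ≤ a) (h : R)
    (hp : ∀ P : Ideal R, P.IsPrime → Iid k a R ≤ P → h ∈ P) : h ∈ Iid k a R := by
  have hr : h ∈ (Iid k a R).radical := by
    rw [Ideal.radical_eq_sInf, Submodule.mem_sInf]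
    rintro P ⟨hle, hP⟩
    exact hp P hP hle
  obtain ⟨n, hn⟩ := hr
  intro r
  have h1 : h ^ (2 ^ n) ∈ Iid k a R := by
    have : 2 ^ n = n + (2 ^ n - n) := by
      have : n < 2 ^ n := Nat.lt_two_pow_self
      omega
    rw [this, pow_add]
    exact Ideal.mul_mem_right _ _ hn
  have h2 := h1 (r ^ (2 ^ n))
  rw [← mul_pow] at h2
  have := sub_mem h2 (pow2_mem_V k a q hk ha (r * h) n)
  simpa using this

lemma gen_mem_I (k a q l : ℕ) (hk : k = 2 ^ a * (2 * q + 1)) (ha : 1 ≤ a) (hl : k = 2 * l)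
    (hl2 : 2 ≤ l) (f : R) : f ^ (l - 1) * (f ^ l - 1) ∈ Iid k a R := by
  intro h
  have h1 := fh_mem_V k a q hk ha f h
  have h2 := sq_mem_V k a q hk ha (f ^ (l - 1) * h)
  have := sub_mem h1 h2
  have h3 := sub_mem this (two_mul_mem_V k a (f ^ (l - 1) * h))
  convert h3 using 1
  obtain ⟨m, rfl⟩ : ∃ m, l = m + 1 := ⟨l - 1, by omega⟩
  have : k - 2 = 2 * m := by omega
  rw [this]
  simp only [Nat.add_sub_cancel]
  ring

lemma dom_aux {K : Type*} [CommRing K] [IsDomain K] (h2 : (2 : K) = 0) (l : ℕ) (hl : 2 ≤ l)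
    (h3 : ¬ 3 ∣ l) (hK : ∀ f : K, f ^ (l - 1) * (f ^ l - 1) = 0) (D : ℕ)
    (hD : ∀ d, Odd d → d ≤ l → d ∣ D) (v : K) : v ^ (2 ^ D) = v := by
  classical
  have hK1 : ∀ f : K, f ≠ 0 → f ^ l = 1 := by
    intro f hf
    rcases mul_eq_zero.mp (hK f) with h | h
    · exact absurd (pow_eq_zero_iff (by omega) |>.mp h) hf
    · exact sub_eq_zero.mp h
  have hfin : Finite K := by
    have : (Set.univ : Set K) ⊆ ((X ^ (l + 1) - X : K[X]).rootSet K) := by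
      intro f _
      rw [Polynomial.mem_rootSet]
      constructor
      · intro h0
        have := congrArg (fun p => p.coeff 1) h0
        have hne : ¬ (1 = l + 1) := by omega
        simp only [coeff_sub, coeff_X_pow, if_neg hne, coeff_X_one, coeff_zero] at this
        simp at this
      · simp only [map_sub, map_pow, aeval_X]
        by_cases hf : f = 0
        · simp [hf]
        · rw [pow_succ, hK1 f hf]; simp
    exact Set.finite_univ_iff.mp ((Polynomial.rootSet_finite _ _).subset this)
  have : Fintype K := Fintype.ofFinite K
  letI : Field K := Fintype.fieldOfDomain K
  haveI : CharP K 2 := CharTwo.of_one_ne_zero_of_two_eq_zero one_ne_zero h2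
  obtain ⟨d, hp, hcard⟩ := FiniteField.card K 2
  have hdl : Fintype.card K - 1 ∣ l := by
    rw [← FiniteField.forall_pow_eq_one_iff]
    intro x
    ext
    simpa using hK1 x x.ne_zero
  rw [hcard] at hdl
  have hodd : Odd (d : ℕ) := by
    by_contra hev
    rw [Nat.not_odd_iff_even] at hev
    obtain ⟨t, ht⟩ := hev
    apply h3
    refine dvd_trans ?_ hdl
    have : 2 ^ (d : ℕ) = 4 ^ t := by rw [ht, ← two_mul, pow_mul]; norm_num
    rw [this]
    simpa using Nat.sub_dvd_pow_sub_pow 4 1 t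
  have hle : (d : ℕ) ≤ l := by
    have h1 := Nat.le_of_dvd (by omega) hdl
    have : (d : ℕ) < 2 ^ (d : ℕ) := Nat.lt_two_pow_self
    omega
  obtain ⟨e, rfl⟩ := hD d hodd hle
  rw [pow_mul, ← hcard]
  exact FiniteField.pow_card_pow e v

lemma exists_D (l : ℕ) : ∃ D, Odd D ∧ ∀ d, Odd d → d ≤ l → d ∣ D := by
  obtain ⟨e, D, hodd, h⟩ := Nat.exists_eq_two_pow_mul_odd (n := l.factorial)
    (Nat.factorial_ne_zero l)
  refine ⟨D, hodd, fun d hd hl => ?_⟩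
  have h1 : d ∣ l.factorial := Nat.dvd_factorial hd.pos hl
  rw [h] at h1
  exact (Nat.Coprime.pow_right _ (Nat.coprime_two_right.mpr hd)).dvd_of_dvd_mul_left h1

lemma all_mem_V (k a q l : ℕ) (hk : k = 2 ^ a * (2 * q + 1)) (ha : 1 ≤ a) (hl : k = 2 * l)
    (hl2 : 2 ≤ l) (h3 : ¬ 3 ∣ l) (v : R) : v ∈ Vgrp k a R := by
  obtain ⟨D, hDo, hD⟩ := exists_D l
  set T : R := ∑ i ∈ Finset.range D, v ^ (2 ^ i) with hT
  have hTI : T ^ 2 - T ∈ Iid k a R := by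
    apply I_rad k a q hk ha
    intro P hP hle
    have h2 : (2 : R ⧸ P) = 0 := by
      have : (2 : R) ∈ P := hle (fun r => by rw [mul_comm]; exact two_mul_mem_V k a r)
      have := Ideal.Quotient.eq_zero_iff_mem.mpr this
      rwa [map_ofNat] at this
    have hK : ∀ f : R ⧸ P, f ^ (l - 1) * (f ^ l - 1) = 0 := by
      intro f
      obtain ⟨f, rfl⟩ := Ideal.Quotient.mk_surjective f
      have := Ideal.Quotient.eq_zero_iff_mem.mpr (hle (gen_mem_I k a q l hk ha hl hl2 f))
      simpa using this
    have hv := dom_aux h2 l hl2 h3 hK D hD (Ideal.Quotient.mk P v)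
    haveI : CharP (R ⧸ P) 2 := CharTwo.of_one_ne_zero_of_two_eq_zero one_ne_zero h2
    rw [← Ideal.Quotient.eq_zero_iff_mem, map_sub, map_pow, hT, map_sum, CharTwo.sum_sq]
    simp only [map_pow, ← pow_mul, ← pow_succ]
    rw [← Finset.sum_sub_distrib, Finset.sum_range_sub (fun i => (Ideal.Quotient.mk P v) ^ 2 ^ i)]
    rw [hv]; simp
  have hTk : T ^ k - T ∈ Iid k a R := by
    have hd : T ^ 2 - T ∣ T ^ k - T := by
      have h1 : T - 1 ∣ T ^ (k - 1) - 1 := by simpa using sub_dvd_pow_sub_pow T 1 (k - 1)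
      have h2 := mul_dvd_mul_left T h1
      convert h2 using 1
      · ring
      · rw [mul_sub, ← pow_succ', mul_one]; congr 2; omega
    exact Ideal.mem_of_dvd _ hd hTI
  have hTV : T ∈ Vgrp k a R := by
    have := sub_mem (pow_mem_V k a q hk T) (I_le k a _ hTk)
    simpa using this
  have hDv : T - D * v ∈ Vgrp k a R := by
    have : T - D * v = ∑ i ∈ Finset.range D, (v ^ (2 ^ i) - v) := by
      rw [Finset.sum_sub_distrib]; simp [hT]
    rw [this]
    exact sum_mem fun i _ => pow2_mem_V k a q hk ha v i
  obtain ⟨e, rfl⟩ := hDo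
  have := sub_mem (sub_mem hTV hDv) (two_mul_mem_V k a (e * v))
  convert this using 1
  push_cast; ring

lemma iterV (k a : ℕ) (h : ∀ v : R, v ∈ Vgrp k a R) (n : ℕ) (v : R) :
    ∃ j ∈ Jgrp k R, ∃ w : R, 2 ^ (a + 1) * v = j + 2 ^ (a + 1 + n) * w := by
  induction n with
  | zero => exact ⟨0, zero_mem _, v, by simp⟩
  | succ n ih =>
    obtain ⟨j, hj, w, hw⟩ := ih
    obtain ⟨j', hj', w', hw'⟩ := h w
    refine ⟨j + (2 ^ n : ℕ) • j', add_mem hj (nsmul_mem hj' _), w', ?_⟩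
    rw [hw, nsmul_eq_mul]; push_cast
    linear_combination 2 ^ n * hw'

lemma exists_N (k : ℕ) (hk : 1 ≤ k) (R : Type*) [CommRing R] :
    ∃ N : ℤ, N ≠ 0 ∧ ∀ r : R, N • r ∈ Jgrp k R := by
  set M : Matrix (Fin (k + 1)) (Fin (k + 1)) ℤ := Matrix.vandermonde (fun i => (i : ℤ)) with hM
  have hdet : M.det ≠ 0 := by
    rw [hM, Matrix.det_vandermonde_ne_zero_iff]
    intro i j h
    ext
    simpa using h
  refine ⟨M.det * k, mul_ne_zero hdet (by exact_mod_cast (by omega : k ≠ 0)), fun r => ?_⟩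
  let c : Fin (k + 1) := ⟨k - 1, by omega⟩
  have key : (M.det * k) • r = ∑ i, M.adjugate c i • ((r + ((i : ℕ) : R)) ^ k) := by
    have h1 : ∀ i : Fin (k + 1), (r + ((i : ℕ) : R)) ^ k =
        ∑ j : Fin (k + 1), (M i j : R) * (r ^ (k - (j : ℕ)) * (k.choose j : R)) := by
      intro i
      rw [add_comm, add_pow, Finset.sum_range]
      refine Finset.sum_congr rfl fun j _ => ?_
      simp [hM, Matrix.vandermonde_apply, mul_assoc]
    have h2 : ∀ j, ∑ i, M.adjugate c i * M i j = if c = j then M.det else 0 := by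
      intro j
      have := congrFun (congrFun (Matrix.adjugate_mul M) c) j
      rw [Matrix.mul_apply] at this
      rw [this]
      simp [Matrix.one_apply]
    calc (M.det * k) • r
        = ∑ j : Fin (k + 1), ((if c = j then M.det else 0 : ℤ) : R) *
            (r ^ (k - (j : ℕ)) * (k.choose j : R)) := by
          rw [Finset.sum_eq_single c]
          · have e1 : k - (k - 1) = 1 := by omega
            have e2 : k.choose (k - 1) = k := by
              rw [Nat.choose_symm hk, Nat.choose_one_right]
            simp [c, e1, e2, zsmul_eq_mul]; ring
          · intro j _ hj
            simp [Ne.symm hj]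
          · simp
      _ = _ := by
          simp_rw [← h2, h1, zsmul_eq_mul, Int.cast_sum, Finset.sum_mul, Finset.mul_sum]
          rw [Finset.sum_comm]
          refine Finset.sum_congr rfl fun i _ => Finset.sum_congr rfl fun j _ => ?_
          push_cast; ring
  rw [key]
  exact sum_mem fun i _ => zsmul_mem (pow_mem_J k _) _

lemma upper (k a q l : ℕ) (hk : k = 2 ^ a * (2 * q + 1)) (ha : 1 ≤ a) (hl : k = 2 * l)
    (hl2 : 2 ≤ l) (h3 : ¬ 3 ∣ l) : ∃ c : ℕ, Odd c ∧ ((2 ^ (a + 1) * c : ℕ) : ℤ) ∈ Ggrp k R := by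
  obtain ⟨N, hN, hNJ⟩ := exists_N k (by omega) R
  obtain ⟨n, c, hc, hNc⟩ := Nat.exists_eq_two_pow_mul_odd (n := N.natAbs) (by omega)
  refine ⟨c, hc, fun r => ?_⟩
  have hNJ' : ∀ r : R, (N.natAbs : ℤ) • r ∈ Jgrp k R := by
    intro r
    rcases Int.natAbs_eq N with h | h
    · rw [← h]; exact hNJ r
    · have : (N.natAbs : ℤ) = -N := by omega
      rw [this, neg_smul]; exact neg_mem (hNJ r)
  obtain ⟨j, hj, w, hw⟩ := iterV k a (fun v => all_mem_V k a q l hk ha hl hl2 h3 v) n r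
  have : ((2 ^ (a + 1) * c : ℕ) : ℤ) • r = c • j + (N.natAbs : ℤ) • (2 ^ (a + 1) * w) := by
    rw [hNc]
    simp only [zsmul_eq_mul, nsmul_eq_mul]
    push_cast
    linear_combination (c : R) * hw
  rw [this]
  exact add_mem (nsmul_mem hj _) (hNJ' _)

end

lemma lower_aux (k s : ℕ) (hks : k = 2 * s + 2) (hs : 1 ≤ s) (g : ℤ[X]) (hg : g ∈ Jgrp k ℤ[X]) :
    (2 * k : ℤ) ∣ (derivative g).coeff 0 + (derivative g).coeff 1 := by
  induction hg using AddSubgroup.closure_induction with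
  | zero => simp
  | add x y _ _ hx hy =>
    obtain ⟨u, hu⟩ := hx
    obtain ⟨v, hv⟩ := hy
    refine ⟨u + v, ?_⟩
    simp only [derivative_add, coeff_add]
    linear_combination hu + hv
  | neg x _ hx =>
    obtain ⟨u, hu⟩ := hx
    refine ⟨-u, ?_⟩
    simp only [derivative_neg, coeff_neg]
    linear_combination -hu
  | mem x hx =>
    obtain ⟨f, rfl⟩ := hx
    have e : derivative (f ^ k) = C (k : ℤ) * ((f ^ s * f ^ s) * (f * derivative f)) := by
      rw [derivative_pow]
      have : k - 1 = s + s + 1 := by omega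
      rw [this]; ring
    rw [e, coeff_C_mul, coeff_C_mul, ← mul_add, mul_comm 2 (k : ℤ)]
    apply mul_dvd_mul_left
    have hu : (f ^ s).coeff 0 = f.coeff 0 ^ s := by
      simp [coeff_zero_eq_eval_zero]
    simp only [mul_coeff_zero, mul_coeff_one, coeff_derivative, hu]
    generalize (f ^ s).coeff 1 = u1
    obtain ⟨t, rfl⟩ : ∃ t, s = t + 1 := ⟨s - 1, by omega⟩
    generalize f.coeff 0 = x
    norm_num
    generalize f.coeff 1 = y
    generalize f.coeff 2 = z
    rw [← even_iff_two_dvd]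
    simp only [pow_succ]
    generalize x ^ t = p
    rcases Int.even_or_odd x with hx | hx <;> rcases Int.even_or_odd y with hy | hy <;>
      rcases Int.even_or_odd p with hp | hp <;> rcases Int.even_or_odd u1 with hu | hu <;>
      (try simp only [← Int.not_even_iff_odd] at *) <;>
      simp [hx, hy, hp, hu, parity_simps]

/-- If `k > 2` is even and not divisible by `6`, then `v₂(m(k)) = v₂(k) + 1`. -/
theorem v2_mval_of_not_six_dvd (k : ℕ) (hk : 2 < k) (hke : Even k) (h6 : ¬ 6 ∣ k) :
    padicValNat 2 (mval k (Polynomial ℤ)) = padicValNat 2 k + 1 := by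
  obtain ⟨a, b, hb, hk'⟩ := Nat.exists_eq_two_pow_mul_odd (n := k) (by omega)
  obtain ⟨q, rfl⟩ := hb
  obtain ⟨l, hl⟩ := hke
  have hl' : k = 2 * l := by omega
  have hv : padicValNat 2 k = a := by
    rw [hk', padicValNat.mul (by positivity) (by omega), padicValNat.prime_pow,
      padicValNat.eq_zero_of_not_dvd (by omega), add_zero]
  have ha : 1 ≤ a := by
    by_contra h
    have : a = 0 := by omega
    subst this
    simp at hk'
    omega
  rw [hv]
  obtain ⟨c, hc, hcG⟩ := upper (R := ℤ[X]) k a q l hk' ha hl' (by omega) (by omega)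
  have hup : mval k ℤ[X] ∣ 2 ^ (a + 1) * c := by
    have := (Submodule.IsPrincipal.mem_iff_generator_dvd (Ggrp k ℤ[X])).mp hcG
    unfold mval
    exact Int.natAbs_dvd_natAbs.mpr this
  have hgen : Submodule.IsPrincipal.generator (Ggrp k ℤ[X]) ∈ Ggrp k ℤ[X] :=
    Submodule.IsPrincipal.generator_mem _
  have hlow : 2 ^ (a + 1) ∣ mval k ℤ[X] := by
    have h1 := lower_aux k (l - 1) (by omega) (by omega) _ (hgen X)
    have h2 : (2 * k : ℤ) ∣ Submodule.IsPrincipal.generator (Ggrp k ℤ[X]) := by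
      rw [derivative_smul, derivative_X, coeff_smul, coeff_smul] at h1
      simpa [coeff_one] using h1
    have h3 : 2 * k ∣ mval k ℤ[X] := by
      unfold mval
      have := Int.natAbs_dvd_natAbs.mpr h2
      simpa [Int.natAbs_mul] using this
    refine dvd_trans ⟨2 * q + 1, ?_⟩ h3
    conv_lhs => rw [hk']
    ring
  have hne : 2 ^ (a + 1) * c ≠ 0 := mul_ne_zero (by positivity) hc.pos.ne'
  have hm0 : mval k ℤ[X] ≠ 0 := ne_zero_of_dvd_ne_zero hne hup
  apply le_antisymm
  · have h1 : 2 ^ padicValNat 2 (mval k ℤ[X]) ∣ 2 ^ (a + 1) * c := pow_padicValNat_dvd.trans hup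
    have h2 := (Nat.Coprime.pow_left _ (Nat.coprime_two_left.mpr hc)).dvd_of_dvd_mul_right h1
    exact (Nat.pow_dvd_pow_iff_le_right (by norm_num)).mp h2
  · exact (padicValNat_dvd_iff_le hm0).mp hlow
end

section
/- $m(14) = 2548$; in particular, $m(14) \neq 5096$, correcting the formula of Chinburg and Henriksen. -/
open Polynomial

/-! Polynomials as coefficient lists. -/

def lev {R : Type*} [CommRing R] (x : R) : List ℤ → R
  | [] => 0
  | a :: l => (a : R) + x * lev x l

def ladd : List ℤ → List ℤ → List ℤ
  | [], m => m
  | a :: l, [] => a :: l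
  | a :: l, b :: m => (a + b) :: ladd l m

def lsmul (c : ℤ) : List ℤ → List ℤ
  | [] => []
  | a :: l => (c * a) :: lsmul c l

def lmul : List ℤ → List ℤ → List ℤ
  | [], _ => []
  | a :: l, m => ladd (lsmul a m) (0 :: lmul l m)

def lpow (l : List ℤ) : ℕ → List ℤ
  | 0 => [1]
  | n + 1 => lmul l (lpow l n)

def lcomb : List (ℤ × List ℤ) → List ℤ
  | [] => []
  | t :: s => ladd (lsmul t.1 (lpow t.2 14)) (lcomb s)

def ldvd (q : ℤ) : List ℤ → Bool
  | [] => true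
  | a :: l => (a % q == 0) && ldvd q l

section
variable {R : Type*} [CommRing R] (x : R)

theorem lev_ladd (l m : List ℤ) : lev x (ladd l m) = lev x l + lev x m := by
  induction l generalizing m with
  | nil => simp [ladd, lev]
  | cons a l ih =>
    cases m with
    | nil => simp [ladd, lev]
    | cons b m => simp only [ladd, lev, ih]; push_cast; ring

theorem lev_lsmul (c : ℤ) (l : List ℤ) : lev x (lsmul c l) = (c : R) * lev x l := by
  induction l with
  | nil => simp [lsmul, lev]
  | cons a l ih => simp only [lsmul, lev, ih]; push_cast; ring

theorem lev_lmul (l m : List ℤ) : lev x (lmul l m) = lev x l * lev x m := by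
  induction l with
  | nil => simp [lmul, lev]
  | cons a l ih => simp only [lmul, lev, ih, lev_ladd, lev_lsmul]; push_cast; ring

theorem lev_lpow (l : List ℤ) (n : ℕ) : lev x (lpow l n) = lev x l ^ n := by
  induction n with
  | zero => simp [lpow, lev]
  | succ n ih => rw [lpow, lev_lmul, ih, pow_succ']

theorem lev_lcomb (t : List (ℤ × List ℤ)) : lev x (lcomb t) ∈ Jgrp 14 R := by
  induction t with
  | nil => simpa [lcomb, lev] using (Jgrp 14 R).zero_mem
  | cons a t ih =>
    rw [lcomb, lev_ladd, lev_lsmul, lev_lpow, ← zsmul_eq_mul]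
    exact (Jgrp 14 R).add_mem
      ((Jgrp 14 R).zsmul_mem (AddSubgroup.subset_closure ⟨_, rfl⟩) _) ih

theorem lev_ldvd (q : ℤ) (l : List ℤ) (h : ldvd q l = true) :
    ∃ r : R, lev x l = (q : R) * r := by
  induction l with
  | nil => exact ⟨0, by simp [lev]⟩
  | cons a l ih =>
    simp only [ldvd, Bool.and_eq_true, beq_iff_eq] at h
    obtain ⟨r, hr⟩ := ih h.2
    obtain ⟨b, hb⟩ := Int.dvd_of_emod_eq_zero h.1
    refine ⟨b + x * r, ?_⟩
    rw [lev, hr, hb]; push_cast; ring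

end

theorem cert_step (K q u N : ℤ) (t : List (ℤ × List ℤ))
    (hm : K * q ∈ Ggrp 14 ℤ[X])
    (hc : ldvd q (ladd (lcomb t) [0, -u]) = true)
    (hg : ((Int.gcd (K * q) (K * u) : ℕ) : ℤ) = N) : N ∈ Ggrp 14 ℤ[X] := by
  have hu : K * u ∈ Ggrp 14 ℤ[X] := by
    intro r
    obtain ⟨s, hs⟩ := lev_ldvd r q _ hc
    have h1 := (Jgrp 14 ℤ[X]).zsmul_mem (lev_lcomb r t) K
    have h2 := hm s
    have h3 := (Jgrp 14 ℤ[X]).sub_mem h1 h2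
    convert h3 using 1
    rw [lev_ladd] at hs
    simp only [lev] at hs
    simp only [zsmul_eq_mul]
    push_cast at hs ⊢
    linear_combination (-(K : ℤ[X])) * hs
  rw [← hg, Int.gcd_eq_gcd_ab]
  exact Ideal.add_mem _ (Ideal.mul_mem_right _ _ hm) (Ideal.mul_mem_right _ _ hu)

/-! Lower bound. -/

theorem coeff_one_pow' {R : Type*} [CommRing R] (g : R[X]) (n : ℕ) :
    (g ^ (n + 1)).coeff 1 = (n + 1) * g.coeff 0 ^ n * g.coeff 1 := by
  have h : (derivative (g ^ (n + 1))).coeff 0 = (g ^ (n + 1)).coeff 1 := by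
    rw [coeff_derivative]; simp
  rw [← h, derivative_pow_succ]
  have h2 : eval 0 (derivative g) = g.coeff 1 := by
    rw [← coeff_zero_eq_eval_zero, coeff_derivative]; simp
  rw [coeff_zero_eq_eval_zero, eval_mul, eval_mul, eval_C, eval_pow, h2, ← coeff_zero_eq_eval_zero]

theorem coeff7 (g : ℤ[X]) : (7 : ℤ) ∣ (g ^ 14).coeff 7 - 2 * g.coeff 0 * g.coeff 1 := by
  haveI : Fact (Nat.Prime 7) := ⟨by norm_num⟩
  apply (ZMod.intCast_zmod_eq_zero_iff_dvd _ 7).1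
  set f := g.map (Int.castRingHom (ZMod 7)) with hf
  have h1 : (((g ^ 14).coeff 7 : ℤ) : ZMod 7) = (f ^ 14).coeff 7 := by
    rw [hf, ← Polynomial.map_pow, coeff_map]; rfl
  have h2 : f ^ 14 = expand (ZMod 7) 7 (f ^ 2) := by
    rw [ZMod.expand_card, ← pow_mul]
  have h3 : (f ^ 14).coeff 7 = 2 * f.coeff 0 * f.coeff 1 := by
    rw [h2]
    have := coeff_expand_mul (p := 7) (by norm_num) (f ^ 2) 1
    rw [one_mul] at this
    rw [this, coeff_one_pow']; norm_num
  push_cast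
  rw [h1, h3, hf, coeff_map, coeff_map]; simp

theorem coeff2 (g : ℤ[X]) : (2 : ℤ) ∣ (g ^ 14).coeff 2 - 7 * g.coeff 0 ^ 6 * g.coeff 1 := by
  haveI : Fact (Nat.Prime 2) := ⟨by norm_num⟩
  apply (ZMod.intCast_zmod_eq_zero_iff_dvd _ 2).1
  set f := g.map (Int.castRingHom (ZMod 2)) with hf
  have h1 : (((g ^ 14).coeff 2 : ℤ) : ZMod 2) = (f ^ 14).coeff 2 := by
    rw [hf, ← Polynomial.map_pow, coeff_map]; rfl
  have h2 : f ^ 14 = expand (ZMod 2) 2 (f ^ 7) := by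
    rw [ZMod.expand_card, ← pow_mul]
  have h3 : (f ^ 14).coeff 2 = 7 * f.coeff 0 ^ 6 * f.coeff 1 := by
    rw [h2]
    have := coeff_expand_mul (p := 2) (by norm_num) (f ^ 7) 1
    rw [one_mul] at this
    rw [this, coeff_one_pow']; norm_num
  push_cast
  rw [h1, h3, hf, coeff_map, coeff_map]; simp

theorem dvd_functional (d : ℤ) (L : ℤ[X] →+ ℤ) (h : ∀ g : ℤ[X], d ∣ L (g ^ 14))
    (f : ℤ[X]) (hf : f ∈ Jgrp 14 ℤ[X]) : d ∣ L f := by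
  induction hf using AddSubgroup.closure_induction with
  | mem x hx => obtain ⟨g, rfl⟩ := hx; exact h g
  | zero => simp
  | add x y _ _ hx hy => rw [map_add]; exact dvd_add hx hy
  | neg x _ hx => rw [map_neg]; exact (dvd_neg).2 hx

theorem dvd49 (m : ℤ) (hm : m ∈ Ggrp 14 ℤ[X]) : 49 ∣ m := by
  let L : ℤ[X] →+ ℤ := (lcoeff ℤ 1).toAddMonoidHom - (7 : ℤ) • (lcoeff ℤ 7).toAddMonoidHom
  have hL : ∀ f, L f = f.coeff 1 - 7 * f.coeff 7 := fun f => by simp [L]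
  have := dvd_functional 49 L (fun g => by
    rw [hL, coeff_one_pow']
    obtain ⟨c, hc⟩ := coeff7 g
    have h13 : (7 : ℤ) ∣ g.coeff 0 ^ 13 - g.coeff 0 := by
      apply (ZMod.intCast_zmod_eq_zero_iff_dvd _ 7).1
      push_cast
      generalize ((g.coeff 0 : ℤ) : ZMod 7) = a
      revert a; decide
    obtain ⟨e, he⟩ := h13
    refine ⟨2 * e * g.coeff 1 - c, ?_⟩
    push_cast
    linear_combination 14 * g.coeff 1 * he - 7 * hc) _ (hm X)
  rw [hL] at this
  rw [coeff_smul, coeff_smul] at this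
  simpa [coeff_X] using this

theorem dvd4 (m : ℤ) (hm : m ∈ Ggrp 14 ℤ[X]) : 4 ∣ m := by
  let L : ℤ[X] →+ ℤ := (lcoeff ℤ 1).toAddMonoidHom - (2 : ℤ) • (lcoeff ℤ 2).toAddMonoidHom
  have hL : ∀ f, L f = f.coeff 1 - 2 * f.coeff 2 := fun f => by simp [L]
  have := dvd_functional 4 L (fun g => by
    rw [hL, coeff_one_pow']
    obtain ⟨c, hc⟩ := coeff2 g
    have h13 : (2 : ℤ) ∣ g.coeff 0 ^ 13 - g.coeff 0 ^ 6 := by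
      apply (ZMod.intCast_zmod_eq_zero_iff_dvd _ 2).1
      push_cast
      generalize ((g.coeff 0 : ℤ) : ZMod 2) = a
      revert a; decide
    obtain ⟨e, he⟩ := h13
    refine ⟨7 * e * g.coeff 1 - c, ?_⟩
    push_cast
    linear_combination 14 * g.coeff 1 * he - 2 * hc) _ (hm X)
  rw [hL] at this
  rw [coeff_smul, coeff_smul] at this
  simpa [coeff_X] using this

def pw13 (a b : ZMod 13) : ℕ → ZMod 13 × ZMod 13
  | 0 => (1, 0)
  | n + 1 => ((pw13 a b n).1 * a + 2 * (pw13 a b n).2 * b,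
      (pw13 a b n).1 * b + (pw13 a b n).2 * a)

theorem pw13_eq (z : ℤ√2) (n : ℕ) :
    pw13 z.re z.im n = (((z ^ n).re : ZMod 13), ((z ^ n).im : ZMod 13)) := by
  induction n with
  | zero => simp [pw13]
  | succ n ih =>
    rw [pw13, ih, pow_succ]
    simp only [Zsqrtd.re_mul, Zsqrtd.im_mul]
    push_cast
    rfl

theorem pw13_zero : ∀ a b : ZMod 13, (pw13 a b 14).2 = 0 := by decide +kernel

theorem dvd13 (m : ℤ) (hm : m ∈ Ggrp 14 ℤ[X]) : 13 ∣ m := by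
  let φ : ℤ[X] →+* ℤ√2 := (aeval (Zsqrtd.sqrtd : ℤ√2)).toRingHom
  let L : ℤ[X] →+ ℤ :=
    { toFun := fun f => (φ f).im, map_zero' := by simp, map_add' := fun a b => by simp }
  have hL : ∀ f, L f = (φ f).im := fun f => rfl
  have := dvd_functional 13 L (fun g => by
    rw [hL, map_pow]
    apply (ZMod.intCast_zmod_eq_zero_iff_dvd _ 13).1
    have h := pw13_eq (φ g) 14
    have h2 := pw13_zero (φ g).re (φ g).im
    rw [h] at h2
    exact h2) _ (hm X)
  rw [hL] at this
  simpa [φ] using this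

theorem dvd_of_mem (m : ℤ) (hm : m ∈ Ggrp 14 ℤ[X]) : 2548 ∣ m := by
  have h1 := dvd4 m hm
  have h2 := dvd13 m hm
  have h3 := dvd49 m hm
  omega


def cert0 : List (ℤ × List ℤ) :=
  [(-1, [0,1]), (13, [1,1]), (-78, [2,1]), (286, [3,1]), (-715, [4,1]), (1287, [5,1]),
   (-1716, [6,1]), (1716, [7,1]), (-1287, [8,1]), (715, [9,1]), (-286, [10,1]), (78, [11,1]),
   (-13, [12,1]), (1, [13,1]), (-566658892800, [1])]

def cert1 : List (ℤ × List ℤ) :=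
  [(1, [1,64]), (2047, [1])]

def cert2 : List (ℤ × List ℤ) :=
  [(1, [1,16]), (127, [1])]

def cert3 : List (ℤ × List ℤ) :=
  [(1, [1,8]), (31, [1])]

def cert4 : List (ℤ × List ℤ) :=
  [(1, [1,4]), (15, [1])]

def cert5 : List (ℤ × List ℤ) :=
  [(1, [1,27]), (242, [1])]

def cert6 : List (ℤ × List ℤ) :=
  [(1, [1,9]), (26, [1])]

def cert7 : List (ℤ × List ℤ) :=
  [(1, [1,3]), (8, [1])]

def cert8 : List (ℤ × List ℤ) :=
  [(1, [1,5]), (24, [1])]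

def cert9 : List (ℤ × List ℤ) :=
  [(1, [-1,0,-1,-1,1]), (2, [0,-1,1,-1,1]), (1, [1,0,-1,-1,1]), (3, [1,-1,0,0,1]),
   (4, [0,0,0,1,-1]), (2, [0,-1,0,-1]), (-3, [1,0,0,1,-1]), (3, [0,-1,-1]), (3, [0,-1,1]),
   (3, [-1,0,1]), (1, [0,1,1,0,1]), (-1, [0,1,0,1,-1]), (4, [1,0,0,-1]), (4, [-1,0,0,0,-1]),
   (1, [0,1,-1,0,1]), (-2, [0,1,0,-1,1]), (-1, [-1,-1,0,-1]), (-1, [0,1,0,0,1]),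
   (4, [-1,1,0,1]), (4, [-1,0,1,1]), (2, [1,1,1]), (-3, [-1,-1,0,1]), (4, [-1,0,-1,-1]),
   (-2, [0,-1]), (3, [1,1]), (4, [1,0,0,-1,-1]), (2, [-1,0,0,-1]), (-2, [1,0,-1,1]),
   (4, [-1,0,-1,0,-1]), (1, [-1,1]), (-2, [0,0,-1,0,-1]), (2, [0,0,1,0,-1]), (-3, [0,0,-1,1]),
   (-2, [-1,0,0,0,1]), (-1, [0,0,1,1]), (-2, [1,-1,1]), (-1, [-1,0,-1]), (2, [1,0,1,0,-1]),
   (-3, [0,1,0,-1,-1]), (1, [1,0,0,1,1]), (2, [0,-1,-1,-1]), (1, [-1,1,0,0,1]),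
   (-1, [0,1,0,0,-1]), (6, [1])]

def cert10 : List (ℤ × List ℤ) :=
  [(1, [-1,0,-1,1]), (1, [0,1,0,0,1,0,1]), (-1, [-1,0,0,-1]), (-1, [0,0,0,1,-1]), (-1, [0,1,1]),
   (1, [0,0,1,-1,0,1]), (-1, [1,0,0,1,0,1]), (1, [0,0,0,0,0,0,-1]), (-1, [0,0,0,0,0,-1,1]),
   (-1, [0,0,0,0,1,-1]), (-1, [1,0,0,0,0,0,1]), (1, [1,0,0,0,1]), (1, [0,0,-1,1,0,0,-1]),
   (-1, [0,0,1,0,0,0,-1]), (1, [0,0,1,0,0,1,1]), (-1, [1,0,0,0,0,0,-1]), (-1, [-1,-1,0,0,-1]),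
   (1, [0,1,0,0,1,-1]), (1, [0,0,0,0,-1,-1,-1]), (-1, [-1,-1,0,0,0,-1]), (1, [0,0,-1,-1,0,-1]),
   (1, [1,-1,0,0,0,0,-1]), (-1, [0,1,-1,0,0,0,-1]), (-1, [1,0,0,0,0,1]), (-1, [0,-1,0,0,-1]),
   (-1, [0,0,1]), (1, [0,1,1,0,0,0,-1]), (-1, [-1,0,0,0,0,1]), (-1, [0,-1,1]),
   (-1, [0,0,0,1,0,1]), (1, [0,0,1,-1]), (-1, [-1,-1,0,0,0,1]), (-1, [0,0,0,0,0,1]),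
   (-1, [0,-1,1,0,0,0,-1]), (-1, [1,0,0,-1,0,0,1]), (1, [1,0,0,-1]), (-1, [0,0,0,1,1,-1]),
   (1, [0,0,-1,0,-1]), (-1, [0,0,0,0,-1,0,-1]), (1, [0,0,-1,0,-1,0,-1]), (-1, [0,0,-1,0,0,-1]),
   (1, [0,0,0,0,-1,0,1]), (1, [0,0,-1,-1]), (1, [-1,0,0,1,0,1]), (-1, [0,0,-1,-1,0,0,-1]),
   (1, [0,-1,0,0,1]), (1, [0,1,0,-1]), (2, [1])]

def cert11 : List (ℤ × List ℤ) :=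
  [(1, [-1,1,1,-1]), (2, [0,0,1,1,1]), (-2, [0,-1,0,1,-1]), (1, [0,1,1,-1]), (-1, [0,-1,0,-1]),
   (-2, [-1,0,-1,-1]), (1, [-1,0,0,-1,-1]), (-2, [1,-1,0,0,-1]), (1, [1,1,0,-1]),
   (-2, [1,0,1,0,1]), (1, [-1,-1,-1]), (2, [0,-1,1,0,1]), (-1, [-1,0,1]), (1, [-1,0,0,0,-1]),
   (-1, [0,0,-1,0,1]), (2, [0,1,1]), (-2, [0,-1,-1,-1]), (2, [0,-1,-1,0,1]), (-1, [1,0,1,0,-1]),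
   (2, [0,1]), (-1, [-1,0,-1]), (-1, [0,0,0,-1]), (-1, [-1,1]), (2, [0,1,0,1,1]),
   (-2, [0,1,0,0,-1]), (-2, [0,-1,0,-1,1]), (-1, [-1,0,1,1]), (-2, [-1,0,1,0,1]),
   (2, [0,0,1,-1]), (1, [0,0,1]), (-1, [0,-1,0,1,1]), (2, [0,0,0,0,1]), (-2, [0,0,0,-1,1]),
   (-1, [-1,-1,0,0,-1]), (-2, [0,0,-1,0,-1]), (-1, [1,1,0,0,-1]), (-1, [-1,0,0,0,1]),
   (-2, [1,0,0,-1]), (3, [1])]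

def cert12 : List (ℤ × List ℤ) :=
  [(1, [0,0,1,-1,-1]), (1, [0,0,-1,-1,-1]), (3, [0,0,0,-1,-1]), (5, [0,0,0,1,-1]),
   (3, [0,0,0,0,1]), (-2, [0,0,0,-1]), (3, [0,0,-1,1]), (-2, [0,0,-1,-1]), (-1, [0,0,1,0,1]),
   (-1, [-1,0,0,1]), (-5, [1,0,0,-1,-1]), (5, [1,0,0,0,1]), (5, [1,0,0,0,-1]),
   (-1, [0,0,-1,0,1]), (-5, [-1,0,0,1,-1]), (2, [0,0,2,1]), (5, [1,2]), (-5, [0,1]),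
   (3, [-1,-1]), (-1, [-1,1]), (5, [1])]


theorem mem_2548 : (2548 : ℤ) ∈ Ggrp 14 ℤ[X] := by
  have h0 : (1 * 0 : ℤ) ∈ Ggrp 14 ℤ[X] := by simp
  have h1 : (87178291200 : ℤ) ∈ Ggrp 14 ℤ[X] :=
    cert_step 1 0 87178291200 87178291200 cert0 (by simpa using h0) (by decide +kernel) (by norm_num)
  have h2 : (5448643200 : ℤ) ∈ Ggrp 14 ℤ[X] :=
    cert_step 42567525 2048 896 5448643200 cert1 (by norm_num; exact h1) (by decide +kernel) (by norm_num)
  have h3 : (1362160800 : ℤ) ∈ Ggrp 14 ℤ[X] :=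
    cert_step 42567525 128 224 1362160800 cert2 (by norm_num; exact h2) (by decide +kernel) (by norm_num)
  have h4 : (681080400 : ℤ) ∈ Ggrp 14 ℤ[X] :=
    cert_step 42567525 32 112 681080400 cert3 (by norm_num; exact h3) (by decide +kernel) (by norm_num)
  have h5 : (340540200 : ℤ) ∈ Ggrp 14 ℤ[X] :=
    cert_step 42567525 16 56 340540200 cert4 (by norm_num; exact h4) (by decide +kernel) (by norm_num)
  have h6 : (37837800 : ℤ) ∈ Ggrp 14 ℤ[X] :=
    cert_step 1401400 243 378 37837800 cert5 (by norm_num; exact h5) (by decide +kernel) (by norm_num)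
  have h7 : (12612600 : ℤ) ∈ Ggrp 14 ℤ[X] :=
    cert_step 1401400 27 126 12612600 cert6 (by norm_num; exact h6) (by decide +kernel) (by norm_num)
  have h8 : (4204200 : ℤ) ∈ Ggrp 14 ℤ[X] :=
    cert_step 1401400 9 42 4204200 cert7 (by norm_num; exact h7) (by decide +kernel) (by norm_num)
  have h9 : (840840 : ℤ) ∈ Ggrp 14 ℤ[X] :=
    cert_step 168168 25 70 840840 cert8 (by norm_num; exact h8) (by decide +kernel) (by norm_num)
  have h10 : (420420 : ℤ) ∈ Ggrp 14 ℤ[X] :=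
    cert_step 105105 8 4 420420 cert9 (by norm_num; exact h9) (by decide +kernel) (by norm_num)
  have h11 : (140140 : ℤ) ∈ Ggrp 14 ℤ[X] :=
    cert_step 140140 3 1 140140 cert10 (by norm_num; exact h10) (by decide +kernel) (by norm_num)
  have h12 : (28028 : ℤ) ∈ Ggrp 14 ℤ[X] :=
    cert_step 28028 5 3 28028 cert11 (by norm_num; exact h11) (by decide +kernel) (by norm_num)
  have h13 : (2548 : ℤ) ∈ Ggrp 14 ℤ[X] :=
    cert_step 2548 11 9 2548 cert12 (by norm_num; exact h12) (by decide +kernel) (by norm_num)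
  exact h13

theorem mval_aux : mval 14 (Polynomial ℤ) = 2548 := by
  have h1 : Submodule.IsPrincipal.generator (Ggrp 14 ℤ[X]) ∣ 2548 :=
    (Submodule.IsPrincipal.mem_iff_generator_dvd _).1 mem_2548
  have h2 : (2548 : ℤ) ∣ Submodule.IsPrincipal.generator (Ggrp 14 ℤ[X]) :=
    dvd_of_mem _ (Submodule.IsPrincipal.generator_mem _)
  unfold mval
  have := Int.natAbs_eq_of_dvd_dvd h1 h2
  simpa using this

/-- `m(14) = 2548`; in particular `m(14) ≠ 5096`, correcting Chinburg–Henriksen. -/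
theorem mval_fourteen : mval 14 (Polynomial ℤ) = 2548 ∧ mval 14 (Polynomial ℤ) ≠ 5096 := by
  exact ⟨mval_aux, by rw [mval_aux]; norm_num⟩
end
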